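/- In the planted model 𝒢(n,1/2,k,t), if M ⊆ [n]×[t] and T is a set of pairs such that (M,T) is inconsistent, then E_{(G,X)}[χ_T(G)·X_M] = 0. -/

import Mathlib

open Finset Classical

/-- An ordered planting: `t` pairwise disjoint `k`-element subsets of `[n]`. -/
def IsPlanting (n k t : ℕ) (C : Fin t → Finset (Fin n)) : Prop :=
  (∀ i, (C i).card = k) ∧ ∀ i j : Fin t, i ≠ j → Disjoint (C i) (C j)

instance (n k t : ℕ) : DecidablePred (IsPlanting n k t) := fun C =>
  inferInstanceAs (Decidable
    ((∀ i, (C i).card = k) ∧ ∀ i j : Fin t, i ≠ j → Disjoint (C i) (C j)))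

/-- The type of ordered plantings; the planted model chooses one uniformly at random. -/
abbrev Planting (n k t : ℕ) := {C : Fin t → Finset (Fin n) // IsPlanting n k t C}

/-- The character `χ_T(G) = ∏_{e ∈ T} G_e`, where `G_e = +1` if `e` is an edge of the planted
graph `G` (an edge of `G₀`, given by the indicator `g`, or a pair of distinct vertices inside
a common planted clique `C_r`) and `G_e = −1` otherwise. -/
noncomputable def chi (n t : ℕ) (T : Finset (Sym2 (Fin n)))
    (C : Fin t → Finset (Fin n)) (g : Sym2 (Fin n) → Bool) : ℝ :=
  ∏ e ∈ T,
    (if ¬e.IsDiag ∧ (g e = true ∨ ∃ r : Fin t, ∀ v ∈ e, v ∈ C r) then (1 : ℝ) else -1)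

/-- `X_M = ∏_{(i,j) ∈ M} x_{i,j}`, where `x_{i,j} = 1` iff `i ∈ C_j`. -/
noncomputable def XM (n t : ℕ) (M : Finset (Fin n × Fin t))
    (C : Fin t → Finset (Fin n)) : ℝ :=
  ∏ p ∈ M, (if p.1 ∈ C p.2 then (1 : ℝ) else 0)

/-- Expectation in the planted model `𝒢(n,1/2,k,t)`: average over a uniformly random ordered
planting and an independent uniformly random background graph. -/
noncomputable def plantedExp (n k t : ℕ)
    (f : (Fin t → Finset (Fin n)) → (Sym2 (Fin n) → Bool) → ℝ) : ℝ :=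
  (∑ C : Planting n k t, ∑ g : Sym2 (Fin n) → Bool, f C.1 g) /
    ((Fintype.card (Planting n k t) : ℝ) * (Fintype.card (Sym2 (Fin n) → Bool) : ℝ))

/-- `(M,T)` is consistent if there is an assignment of labels to vertices with `ℓ(i) = j` for
every `(i,j) ∈ M` and `ℓ(u) = ℓ(v)` for every pair `{u,v} ∈ T`. -/
def Consistent (n t : ℕ) (M : Finset (Fin n × Fin t)) (T : Finset (Sym2 (Fin n))) : Prop :=
  ∃ f : Fin n → Fin t,
    (∀ p ∈ M, f p.1 = p.2) ∧ ∀ e ∈ T, ∀ u ∈ e, ∀ v ∈ e, f u = f v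

/-- If every pair of `T` lies inside a planted set and every membership in `M` holds, then the
planting labels witness consistency. -/
theorem consistent_of_planting {n k t : ℕ} (ht : 0 < t) {M : Finset (Fin n × Fin t)}
    {T : Finset (Sym2 (Fin n))} {C : Fin t → Finset (Fin n)} (hC : IsPlanting n k t C)
    (hM : ∀ p ∈ M, p.1 ∈ C p.2) (hT : ∀ e ∈ T, ∃ r : Fin t, ∀ v ∈ e, v ∈ C r) :
    Consistent n t M T := by
  let f : Fin n → Fin t := fun v => if h : ∃ r, v ∈ C r then h.choose else ⟨0, ht⟩
  have hf : ∀ v r, v ∈ C r → f v = r := by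
    intro v r hv
    have h : ∃ r, v ∈ C r := ⟨r, hv⟩
    have hfv : f v = h.choose := dif_pos h
    rw [hfv]
    by_contra hne
    exact Finset.disjoint_left.mp (hC.2 _ _ hne) h.choose_spec hv
  refine ⟨f, fun p hp => hf _ _ (hM p hp), fun e he u hu v hv => ?_⟩
  obtain ⟨r, hr⟩ := hT e he
  rw [hf u r (hr u hu), hf v r (hr v hv)]

/-- Flipping the background indicator of a pair of `T` outside all planted sets negates `χ_T`. -/
theorem chi_update_not {n t : ℕ} {T : Finset (Sym2 (Fin n))} {C : Fin t → Finset (Fin n)}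
    {e : Sym2 (Fin n)} (he : e ∈ T) (hd : ¬e.IsDiag)
    (hC : ¬∃ r : Fin t, ∀ v ∈ e, v ∈ C r) (g : Sym2 (Fin n) → Bool) :
    chi n t T C (Function.update g e (!g e)) = -chi n t T C g := by
  unfold chi
  rw [← Finset.mul_prod_erase T _ he, ← Finset.mul_prod_erase T _ he, ← neg_mul]
  congr 1
  · cases hg : g e <;> simp [hd, hC]
  · refine Finset.prod_congr rfl fun x hx => ?_
    rw [Function.update_of_ne (Finset.ne_of_mem_erase hx)]

/-- The average of `χ_T` over the background graph vanishes when some pair of `T` lies outside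
all planted sets. -/
theorem sum_chi_eq_zero {n t : ℕ} {T : Finset (Sym2 (Fin n))} {C : Fin t → Finset (Fin n)}
    {e : Sym2 (Fin n)} (he : e ∈ T) (hd : ¬e.IsDiag)
    (hC : ¬∃ r : Fin t, ∀ v ∈ e, v ∈ C r) :
    ∑ g : Sym2 (Fin n) → Bool, chi n t T C g = 0 := by
  refine Finset.sum_involution (fun g _ => Function.update g e (!g e)) ?_ ?_ ?_ ?_
  · intro g _
    rw [chi_update_not he hd hC, add_neg_cancel]
  · intro g _ _ h
    simpa using congrFun h e
  · intro g _
    exact Finset.mem_univ _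
  · intro g _
    simp

/-- In the planted model `𝒢(n,1/2,k,t)`, if `(M,T)` is inconsistent then
`E[χ_T(G)·X_M] = 0`. -/
theorem planted_expectation_inconsistent (n k t : ℕ) (hk : 0 < k) (ht : 0 < t)
    (hkt : k * t ≤ n) (M : Finset (Fin n × Fin t)) (T : Finset (Sym2 (Fin n)))
    (hT : ∀ e ∈ T, ¬e.IsDiag) (hinc : ¬Consistent n t M T) :
    plantedExp n k t (fun C g => chi n t T C g * XM n t M C) = 0 := by
  unfold plantedExp
  rw [div_eq_zero_iff]
  left
  refine Finset.sum_eq_zero fun C _ => ?_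
  rw [← Finset.sum_mul]
  by_cases hM : ∀ p ∈ M, p.1 ∈ C.1 p.2
  · have hex : ∃ e ∈ T, ¬∃ r : Fin t, ∀ v ∈ e, v ∈ C.1 r := by
      by_contra h
      refine hinc (consistent_of_planting ht C.2 hM fun e he => ?_)
      by_contra hr
      exact h ⟨e, he, hr⟩
    obtain ⟨e, he, hr⟩ := hex
    rw [sum_chi_eq_zero he (hT e he) hr, zero_mul]
  · push Not at hM
    obtain ⟨p, hp, hpC⟩ := hM
    have hX : XM n t M C.1 = 0 := Finset.prod_eq_zero hp (if_neg hpC)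
    rw [hX, mul_zero]
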